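/- Let G_{n,k} count n-node planted plane trees with decreasing labels from {1,...,k}, and let α_k = 1/z_{k-1}* where z_{k-1}* is the smallest positive root of G_{k-1}(z) = 1. Then for each k ≥ 2 there is a constant c_k > 0 with G_{n,k} = c_k α_k^n (1 + o(1)) as n → ∞, and 2(k−1)(1 − 1/(√2 (k−1)^{1/4})) ≤ α_k ≤ 1/(k−1−√((k−1)²−1)). -/

import Mathlib

open Real Finset Filter

/-- The generating functions `G_k` of planted plane trees with decreasing
labels from `{1, ..., k}`, viewed as real functions: `G 1 z = z` and
`G k z = G (k-1) z + z / (1 - G (k-1) z)` for `k ≥ 2`.  (`G 0` is junk.) -/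
noncomputable def G : ℕ → ℝ → ℝ
  | 0, z => z
  | 1, z => z
  | (k + 2), z => G (k + 1) z + z / (1 - G (k + 1) z)

/-- A planted plane tree with natural-number labels: a labelled root together
with an ordered list of labelled subtrees. -/
inductive LTree where
  | node : ℕ → List LTree → LTree

/-- The label of the root. -/
def LTree.label : LTree → ℕ
  | .node l _ => l

/-- The number of nodes. -/
def LTree.size : LTree → ℕ
  | .node _ c => 1 + (c.attach.map (fun t => LTree.size t.1)).sum
decreasing_by have := List.sizeOf_lt_of_mem t.2; simp at *; omega

/-- Labels strictly decrease along every root-to-leaf path, i.e. every child's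
label is strictly smaller than its parent's label. -/
inductive LTree.Dec : LTree → Prop
  | node (l : ℕ) (c : List LTree) (h1 : ∀ t ∈ c, t.label < l)
      (h2 : ∀ t ∈ c, LTree.Dec t) : LTree.Dec (.node l c)

/-- All labels belong to {1, ..., k}. -/
inductive LTree.Bounded (k : ℕ) : LTree → Prop
  | node (l : ℕ) (c : List LTree) (h1 : 1 ≤ l) (h2 : l ≤ k)
      (h : ∀ t ∈ c, LTree.Bounded k t) : LTree.Bounded k (.node l c)

/-- `Gcount n k` is the number of planted plane trees on `n` nodes with labels
from `{1, ..., k}` that strictly decrease along every root-to-leaf path. -/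
noncomputable def Gcount (n k : ℕ) : ℕ :=
  Set.ncard {t : LTree | t.size = n ∧ t.Dec ∧ t.Bounded k}

/-! ### The inverse orbit -/

/-- The orbit of `0` under the inverse of `x ↦ x - 1 / x` on the positive reals. -/
noncomputable def invOrbit : ℕ → ℝ
  | 0 => 0
  | n + 1 => (invOrbit n + √(invOrbit n ^ 2 + 4)) / 2

/-- The orbit of `1` under `b ↦ b - z / b`; it is the complement `1 - G n z` for `n ≥ 1`. -/
noncomputable def gCompl (z : ℝ) : ℕ → ℝ
  | 0 => 1
  | n + 1 => gCompl z n - z / gCompl z n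

theorem one_sub_G_succ (n : ℕ) (z : ℝ) : 1 - G (n + 1) z = gCompl z (n + 1) := by
  induction n with
  | zero => simp [G, gCompl]
  | succ n ih =>
    rw [gCompl, ← ih, G]
    ring

theorem invOrbit_nonneg (n : ℕ) : 0 ≤ invOrbit n := by
  induction n with
  | zero => exact le_rfl
  | succ n ih => rw [invOrbit]; positivity

theorem invOrbit_succ_pos (n : ℕ) : 0 < invOrbit (n + 1) := by
  have h := invOrbit_nonneg n
  rw [invOrbit]
  positivity

theorem invOrbit_succ_sub_inv (n : ℕ) :
    invOrbit (n + 1) - 1 / invOrbit (n + 1) = invOrbit n := by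
  have hpos := invOrbit_succ_pos n
  have hs : √(invOrbit n ^ 2 + 4) ^ 2 = invOrbit n ^ 2 + 4 := Real.sq_sqrt (by positivity)
  have hd : √(invOrbit n ^ 2 + 4) = 2 * invOrbit (n + 1) - invOrbit n := by
    rw [invOrbit]; ring
  rw [hd] at hs
  field_simp
  linarith

theorem invOrbit_sq_succ (n : ℕ) :
    invOrbit (n + 1) ^ 2 + 1 / invOrbit (n + 1) ^ 2 = invOrbit n ^ 2 + 2 := by
  have hpos := invOrbit_succ_pos n
  rw [← invOrbit_succ_sub_inv n]
  field_simp
  ring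

theorem invOrbit_lt_succ (n : ℕ) : invOrbit n < invOrbit (n + 1) := by
  have h := one_div_pos.2 (invOrbit_succ_pos n)
  linarith [invOrbit_succ_sub_inv n]

theorem invOrbit_sq_le (n : ℕ) : invOrbit n ^ 2 ≤ 2 * n := by
  induction n with
  | zero => simp [invOrbit]
  | succ n ih =>
    have h : 0 ≤ 1 / invOrbit (n + 1) ^ 2 := by positivity
    push_cast
    linarith [invOrbit_sq_succ n]

theorem le_invOrbit_sq (n : ℕ) : (n : ℝ) ≤ invOrbit n ^ 2 := by
  induction n with
  | zero => simp [invOrbit]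
  | succ n ih =>
    have h1 : 1 ≤ invOrbit (n + 1) := by
      have := invOrbit_nonneg n
      have hs : 2 ≤ √(invOrbit n ^ 2 + 4) := Real.le_sqrt_of_sq_le (by nlinarith)
      rw [invOrbit]
      linarith
    have h2 : 1 / invOrbit (n + 1) ^ 2 ≤ 1 :=
      div_le_one_of_le₀ (one_le_pow₀ h1) (by positivity)
    push_cast
    linarith [invOrbit_sq_succ n]

theorem two_mul_sub_sqrt_le_invOrbit_sq (n : ℕ) :
    2 * ((n : ℝ) + 1) - 2 * √((n : ℝ) + 1) + 1 ≤ invOrbit (n + 1) ^ 2 := by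
  induction n with
  | zero =>
    have := le_invOrbit_sq 1
    norm_num at this ⊢
    linarith
  | succ n ih =>
    have h1 := le_invOrbit_sq (n + 1 + 1)
    push_cast at h1 ⊢
    set a := √((n : ℝ) + 1) with ha
    set b := √((n : ℝ) + 1 + 1) with hb
    have ha2 : a ^ 2 = n + 1 := Real.sq_sqrt (by positivity)
    have hb2 : b ^ 2 = n + 1 + 1 := Real.sq_sqrt (by positivity)
    have hapos : 0 < a := Real.sqrt_pos.2 (by positivity)
    have hbpos : 0 < b := Real.sqrt_pos.2 (by positivity)
    have hab : a ≤ b := Real.sqrt_le_sqrt (by linarith)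
    have h2 : 1 / invOrbit (n + 1 + 1) ^ 2 ≤ 1 / b ^ 2 := by
      rw [hb2]
      exact one_div_le_one_div_of_le (by positivity) h1
    have hb1 : 1 ≤ b := Real.le_sqrt_of_sq_le (by linarith [(n.cast_nonneg : (0 : ℝ) ≤ n)])
    have h3 : 1 / b ^ 2 ≤ 2 * b - 2 * a := by
      rw [div_le_iff₀ (by positivity)]
      have h4 : (b - a) * (b + a) = 1 := by nlinarith
      have h5 : 1 ≤ (b - a) * (2 * b) := by nlinarith
      nlinarith
    linarith [invOrbit_sq_succ (n + 1)]

theorem gCompl_eq_of_mul_invOrbit_eq_one {s : ℝ} (i j : ℕ)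
    (h : s * invOrbit (i + j) = 1) : gCompl (s ^ 2) i = s * invOrbit j := by
  have hs : s ≠ 0 := left_ne_zero_of_mul_eq_one h
  induction i generalizing j with
  | zero => rw [gCompl, ← h, zero_add]
  | succ i ih =>
    have hpos := invOrbit_succ_pos j
    rw [gCompl, ih (j + 1) (by rwa [Nat.add_right_comm, Nat.add_assoc] at h),
      ← invOrbit_succ_sub_inv j]
    field_simp

theorem lt_gCompl_of_mul_invOrbit_lt_one {s : ℝ} (hs : 0 < s) (i j : ℕ)
    (h : s * invOrbit (i + j) < 1) : s * invOrbit j < gCompl (s ^ 2) i := by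
  induction i generalizing j with
  | zero => rwa [zero_add] at h
  | succ i ih =>
    have hpos := invOrbit_succ_pos j
    have hlt := ih (j + 1) (by rwa [Nat.add_right_comm, Nat.add_assoc] at h)
    have hdiv : s ^ 2 / gCompl (s ^ 2) i ≤ s ^ 2 / (s * invOrbit (j + 1)) :=
      div_le_div_of_nonneg_left (by positivity) (by positivity) hlt.le
    have heq : s ^ 2 / (s * invOrbit (j + 1)) = s * (1 / invOrbit (j + 1)) := by field_simp
    rw [gCompl, ← invOrbit_succ_sub_inv j, mul_sub]
    linarith

theorem gCompl_pos_of_mul_invOrbit_sq_lt_one {z : ℝ} (hz : 0 < z) {i n : ℕ} (hi : i ≤ n)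
    (h : z * invOrbit n ^ 2 < 1) : 0 < gCompl z i := by
  obtain ⟨j, rfl⟩ := Nat.exists_eq_add_of_le hi
  have hs := Real.sqrt_pos.2 hz
  have hsq := Real.sq_sqrt hz.le
  have hnn := invOrbit_nonneg (i + j)
  have hlt : √z * invOrbit (i + j) < 1 := by
    rw [← hsq, ← mul_pow] at h
    exact (sq_lt_one_iff₀ (by positivity)).1 h
  have := lt_gCompl_of_mul_invOrbit_lt_one hs i j hlt
  rw [hsq] at this
  exact (mul_nonneg hs.le (invOrbit_nonneg j)).trans_lt this

theorem gCompl_one_div_invOrbit_sq (n : ℕ) :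
    gCompl (1 / invOrbit (n + 1) ^ 2) (n + 1) = 0 := by
  have hpos := invOrbit_succ_pos n
  have := gCompl_eq_of_mul_invOrbit_eq_one (s := 1 / invOrbit (n + 1)) (n + 1) 0
    (by rw [add_zero]; field_simp)
  rw [div_pow, one_pow] at this
  rw [this, invOrbit, mul_zero]

/-- The least positive root of `G (n + 1) z = 1`. -/
theorem isLeast_root_G (n : ℕ) :
    IsLeast {z : ℝ | 0 < z ∧ G (n + 1) z = 1} (1 / invOrbit (n + 1) ^ 2) := by
  have hpos := invOrbit_succ_pos n
  refine ⟨⟨by positivity, ?_⟩, fun z ⟨hz, hG⟩ => ?_⟩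
  · linarith [one_sub_G_succ n (1 / invOrbit (n + 1) ^ 2), gCompl_one_div_invOrbit_sq n]
  · by_contra! hlt
    rw [lt_div_iff₀ (by positivity)] at hlt
    have := gCompl_pos_of_mul_invOrbit_sq_lt_one hz le_rfl hlt
    linarith [one_sub_G_succ n z]

theorem lower_bound_invOrbit_sq (n : ℕ) :
    2 * ((n : ℝ) + 1) * (1 - 1 / (√2 * ((n : ℝ) + 1) ^ ((1 : ℝ) / 4)))
      ≤ invOrbit (n + 1) ^ 2 := by
  refine le_trans ?_ (two_mul_sub_sqrt_le_invOrbit_sq n)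
  set x : ℝ := (n : ℝ) + 1
  have hx : 1 ≤ x := by simp [x]
  set t := x ^ ((1 : ℝ) / 4) with ht
  have ht1 : 1 ≤ t := Real.one_le_rpow hx (by norm_num)
  have ht4 : t ^ 4 = x := by
    rw [ht, ← Real.rpow_natCast, ← Real.rpow_mul (by positivity)]
    norm_num
  have hsx : √x = t ^ 2 := by
    rw [← ht4, show t ^ 4 = (t ^ 2) ^ 2 by ring, Real.sqrt_sq (by positivity)]
  have h2 : √2 ^ 2 = 2 := Real.sq_sqrt (by norm_num)
  have hs2 : 1.4 ≤ √2 := Real.le_sqrt_of_sq_le (by norm_num)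
  have heq : 2 * x * (1 - 1 / (√2 * t)) = 2 * x - √2 * t ^ 3 := by
    rw [← ht4]
    field_simp
    linear_combination h2
  rw [heq, hsx]
  have : 1.4 * t ^ 3 ≤ √2 * t ^ 3 := by gcongr
  nlinarith [mul_nonneg (sub_nonneg.2 ht1) (sq_nonneg (t - 1))]

theorem upper_bound_invOrbit_sq (n : ℕ) :
    invOrbit (n + 1) ^ 2 ≤ 1 / (((n : ℝ) + 1) - √(((n : ℝ) + 1) ^ 2 - 1)) := by
  have hpos := invOrbit_succ_pos n
  set y := invOrbit (n + 1) ^ 2 with hy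
  have hypos : 0 < y := by positivity
  have h1 : y + 1 / y ≤ 2 * ((n : ℝ) + 1) := by
    linarith [invOrbit_sq_succ n, invOrbit_sq_le n]
  have hyz : y * (1 / y) = 1 := by field_simp
  have hn : (0 : ℝ) ≤ n := n.cast_nonneg
  have h2 : (n : ℝ) + 1 - 1 / y ≤ √(((n : ℝ) + 1) ^ 2 - 1) := by
    apply Real.le_sqrt_of_sq_le
    have := one_div_pos.2 hypos
    nlinarith
  have h3 : 0 < ((n : ℝ) + 1) - √(((n : ℝ) + 1) ^ 2 - 1) := by
    rw [sub_pos, Real.sqrt_lt' (by positivity)]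
    linarith
  rw [le_div_iff₀ h3]
  nlinarith

/-! ### Renewal sequences -/

/-- The renewal sequence with increments `f i` at lag `i + 1`. -/
def IsRenewal (f u : ℕ → ℝ) : Prop :=
  u 0 = 1 ∧ ∀ n, u (n + 1) = ∑ i ∈ range (n + 1), f i * u (n - i)

namespace IsRenewal

variable {f u : ℕ → ℝ}

theorem nonneg (h : IsRenewal f u) (hf : ∀ i, 0 ≤ f i) (n : ℕ) : 0 ≤ u n := by
  induction n using Nat.strong_induction_on with
  | _ n ih =>
    cases n with
    | zero => simp [h.1]
    | succ n =>
      rw [h.2]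
      exact sum_nonneg fun i _ => mul_nonneg (hf i) (ih _ (by omega))

/-- Conservation of mass: the tails of `f` convolved with `u` give `1`. -/
theorem sum_tail_mul (h : IsRenewal f u) (n : ℕ) :
    ∑ i ∈ range (n + 1), (1 - ∑ j ∈ range i, f j) * u (n - i) = 1 := by
  induction n with
  | zero => simp [h.1]
  | succ n ih =>
    have hstep : ∀ i ∈ range (n + 1),
        (1 - ∑ j ∈ range (i + 1), f j) * u (n + 1 - (i + 1)) =
          (1 - ∑ j ∈ range i, f j) * u (n - i) - f i * u (n - i) := fun i _ => by
      rw [sum_range_succ, Nat.add_sub_add_right]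
      ring
    rw [sum_range_succ', sum_congr rfl hstep, sum_sub_distrib, ih, ← h.2]
    simp

theorem hasSum_of_lt_one (h : IsRenewal f u) (hf : ∀ i, 0 ≤ f i) {s : ℝ} (hs : HasSum f s)
    (hs1 : s < 1) : HasSum u (1 / (1 - s)) := by
  have hu := h.nonneg hf
  have hpos : 0 < 1 - s := by linarith
  have hsum : Summable u := by
    refine summable_of_sum_range_le (c := 1 / (1 - s)) hu fun n => ?_
    refine (sum_le_sum_of_subset_of_nonneg (range_subset_range.2 n.le_succ)
      fun i _ _ => hu i).trans ?_
    rw [le_div_iff₀ hpos, ← sum_range_reflect, sum_mul]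
    refine (sum_le_sum fun i _ => ?_).trans_eq (h.sum_tail_mul n)
    rw [mul_comm, Nat.succ_sub_one]
    exact mul_le_mul_of_nonneg_right
      (sub_le_sub_left (sum_le_hasSum _ (fun j _ => hf j) hs) 1) (hu _)
  have hconv : s * ∑' n, u n = ∑' n, u (n + 1) := by
    simp_rw [h.2]
    rw [← hs.tsum_eq]
    exact tsum_mul_tsum_eq_tsum_sum_range_of_summable_norm hs.summable.norm hsum.norm
  have htot := hsum.tsum_eq_zero_add
  rw [h.1, ← hconv] at htot
  have heq : ∑' n, u n = 1 / (1 - s) := by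
    rw [eq_div_iff hpos.ne']
    linarith
  exact heq ▸ hsum.hasSum

end IsRenewal

/-- The maximum principle: in a compact shift-invariant set of sequences whose first term is
an `f`-average of the later ones, the largest first term is attained by a constant sequence. -/
theorem exists_max_const {K : Set (ℕ → ℝ)} (hK : IsCompact K) (hne : K.Nonempty)
    (hshift : ∀ v ∈ K, (fun i => v (i + 1)) ∈ K) {f : ℕ → ℝ} (hf : ∀ i, 0 ≤ f i)
    (hs : HasSum f 1) (hf0 : 0 < f 0)
    (havg : ∀ v ∈ K, HasSum (fun i => f i * v (i + 1)) (v 0)) :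
    ∃ v ∈ K, (∀ w ∈ K, w 0 ≤ v 0) ∧ ∀ i, v i = v 0 := by
  have hiter : ∀ v ∈ K, ∀ n, (fun i => v (i + n)) ∈ K := fun v hv n => by
    induction n with
    | zero => exact hv
    | succ n ih =>
      convert! hshift _ ih using 3
      ring
  obtain ⟨v, hv, hmax⟩ := hK.exists_isMaxOn hne (continuous_apply 0).continuousOn
  have hmax' : ∀ w ∈ K, w 0 ≤ v 0 := fun w hw => hmax hw
  refine ⟨v, hv, hmax', fun i => ?_⟩
  have hstep : ∀ w ∈ K, w 0 = v 0 → w 1 = v 0 := fun w hw hw0 => by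
    have hle : ∀ i, w (i + 1) ≤ v 0 := fun i => by
      simpa using hmax' _ (hiter w hw (i + 1))
    have hsub := (hs.mul_right (v 0)).sub (havg w hw)
    rw [hw0, one_mul, sub_self] at hsub
    have hzero := (hasSum_zero_iff_of_nonneg fun i => by
      rw [← mul_sub]
      exact mul_nonneg (hf i) (sub_nonneg.2 (hle i))).1 hsub
    have h0 : f 0 * v 0 - f 0 * w 1 = 0 := congrFun hzero 0
    rw [← mul_sub, mul_eq_zero, or_iff_right hf0.ne'] at h0
    linarith
  induction i with
  | zero => rfl
  | succ i ih =>
    have := hstep _ (hiter v hv i) (by simpa using ih)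
    simpa [add_comm] using this

namespace IsRenewal

variable {f u : ℕ → ℝ}

/-- The renewal theorem for increments of finite mean, lag one having positive probability. -/
theorem tendsto (h : IsRenewal f u) (hf : ∀ i, 0 ≤ f i) (hs : HasSum f 1) (hf0 : 0 < f 0)
    (hq : Summable fun i => 1 - ∑ j ∈ range i, f j) :
    Tendsto u atTop (nhds (1 / ∑' i, (1 - ∑ j ∈ range i, f j))) := by
  set q : ℕ → ℝ := fun i => 1 - ∑ j ∈ range i, f j with hqdef
  have hq0 : ∀ i, 0 ≤ q i := fun i => sub_nonneg.2 (sum_le_hasSum _ (fun j _ => hf j) hs)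
  have hu := h.nonneg hf
  have hu1 : ∀ n, u n ≤ 1 := fun n => by
    rw [← h.sum_tail_mul n]
    have := single_le_sum (f := fun i => q i * u (n - i)) (s := range (n + 1))
      (fun i _ => mul_nonneg (hq0 i) (hu _)) (mem_range.2 n.succ_pos)
    simpa [hqdef] using this
  -- the past of `u` seen from time `n`
  let w : ℕ → ℕ → ℝ := fun n i => if i ≤ n then u (n - i) else 0
  have hw : ∀ n, w n ∈ Set.pi Set.univ fun _ : ℕ => Set.Icc (0 : ℝ) 1 := fun n i _ => by
    by_cases hi : i ≤ n <;> simp [w, hi, hu, hu1]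
  have hcpt : IsCompact (Set.pi Set.univ fun _ : ℕ => Set.Icc (0 : ℝ) 1) :=
    isCompact_univ_pi fun _ => isCompact_Icc
  have hwnorm : ∀ n i, ‖w n i‖ ≤ 1 := fun n i => by
    rw [Real.norm_of_nonneg (hw n i trivial).1]
    exact (hw n i trivial).2
  let K : Set (ℕ → ℝ) := {v | MapClusterPt v atTop w}
  have hKsub : K ⊆ Set.pi Set.univ fun _ : ℕ => Set.Icc (0 : ℝ) 1 := fun v hv =>
    hcpt.isClosed.closure_subset_iff.2 (Set.range_subset_iff.2 hw)
      (hv.mem_closure_of_mem _ Filter.range_mem_map)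
  have hKcpt : IsCompact K := hcpt.of_isClosed_subset isClosed_setOfPred_clusterPt hKsub
  have hlim : ∀ F : Ultrafilter ℕ, (F : Filter ℕ) ≤ atTop →
      ∃ v ∈ K, Tendsto w F (nhds v) := fun F hF => by
    obtain ⟨v, -, hv⟩ := hcpt.ultrafilter_le_nhds (F.map w)
      (le_principal_iff.2 (Filter.mem_map.2 (Filter.univ_mem' hw)))
    exact ⟨v, mapClusterPt_iff_ultrafilter.2 ⟨F, hF, hv⟩, hv⟩
  have hdom : ∀ {g : ℕ → ℝ} (_ : Summable g) (_ : ∀ i, 0 ≤ g i) (m : ℕ) {v : ℕ → ℝ}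
      {F : Ultrafilter ℕ}, Tendsto w F (nhds v) →
      Tendsto (fun n => ∑' i, g i * w n (i + m)) F (nhds (∑' i, g i * v (i + m))) := by
    intro g hg hg0 m v F hv
    refine tendsto_tsum_of_dominated_convergence hg
      (fun i => (tendsto_pi_nhds.1 hv (i + m)).const_mul (g i)) (Eventually.of_forall ?_)
    intro n i
    rw [norm_mul, Real.norm_of_nonneg (hg0 i)]
    exact mul_le_of_le_one_right (hg0 i) (hwnorm n _)
  have hmass : ∀ v ∈ K, ∑' i, q i * v i = 1 := fun v hv => by
    obtain ⟨F, hF, hFv⟩ := mapClusterPt_iff_ultrafilter.1 hv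
    refine tendsto_nhds_unique (hdom hq hq0 0 hFv) (tendsto_const_nhds.congr fun n => ?_)
    rw [tsum_eq_sum (s := range (n + 1)) fun i hi => by
      simp only [mem_range, not_lt] at hi
      simp [w, show ¬ i ≤ n by omega], ← h.sum_tail_mul n]
    refine sum_congr rfl fun i hi => ?_
    simp only [mem_range] at hi
    simp [w, hqdef, show i ≤ n by omega]
  have havg : ∀ v ∈ K, HasSum (fun i => f i * v (i + 1)) (v 0) := fun v hv => by
    obtain ⟨F, hF, hFv⟩ := mapClusterPt_iff_ultrafilter.1 hv
    have heq : ∑' i, f i * v (i + 1) = v 0 := by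
      refine tendsto_nhds_unique (hdom hs.summable hf 1 hFv)
        ((tendsto_pi_nhds.1 hFv 0).congr' (((eventually_ge_atTop 1).filter_mono hF).mono ?_))
      intro n hn
      obtain ⟨n, rfl⟩ := Nat.exists_eq_add_of_le' hn
      beta_reduce
      rw [tsum_eq_sum (s := range (n + 1)) fun i hi => by
        simp only [mem_range, not_lt] at hi
        simp [w, show ¬ i ≤ n by omega]]
      simp only [w, Nat.zero_le, if_true, Nat.sub_zero, h.2]
      refine sum_congr rfl fun i hi => ?_
      simp only [mem_range] at hi
      simp [show i ≤ n by omega]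
    rw [← heq]
    refine (Summable.of_nonneg_of_le
      (fun i => mul_nonneg (hf i) (hKsub hv _ trivial).1)
      (fun i => mul_le_of_le_one_right (hf i) (hKsub hv _ trivial).2) hs.summable).hasSum
  have hshift : ∀ v ∈ K, (fun i => v (i + 1)) ∈ K := fun v hv => by
    obtain ⟨F, hF, hFv⟩ := mapClusterPt_iff_ultrafilter.1 hv
    refine mapClusterPt_iff_ultrafilter.2
      ⟨F.map fun n => n - 1, (tendsto_sub_atTop_nat 1).mono_left hF, ?_⟩
    rw [Ultrafilter.coe_map, tendsto_map'_iff, tendsto_pi_nhds]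
    intro i
    refine (tendsto_pi_nhds.1 hFv (i + 1)).congr'
      (((eventually_ge_atTop 1).filter_mono hF).mono fun n hn => ?_)
    obtain ⟨n, rfl⟩ := Nat.exists_eq_add_of_le' hn
    simp [w]
  obtain ⟨v₀, hv₀, -⟩ := hlim (Ultrafilter.of atTop) (Ultrafilter.of_le _)
  obtain ⟨v, hv, hmax, hconst⟩ := exists_max_const hKcpt ⟨v₀, hv₀⟩ hshift hf hs hf0 havg
  have hval : (∑' i, q i) * v 0 = 1 := by
    rw [← hmass v hv, ← tsum_mul_right]
    exact tsum_congr fun i => by rw [hconst i]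
  -- every other cluster point has first term `v 0` too, since `q 0 = 1`
  have hall : ∀ x ∈ K, x 0 = v 0 := fun x hx => by
    have hle : ∀ y ∈ K, ∀ i, y i ≤ v 0 := fun y hy i => by
      induction i generalizing y with
      | zero => exact hmax y hy
      | succ i ih => exact ih _ (hshift y hy)
    have hsx : Summable fun i => q i * x i := Summable.of_nonneg_of_le
      (fun i => mul_nonneg (hq0 i) (hKsub hx _ trivial).1)
      (fun i => mul_le_of_le_one_right (hq0 i) (hKsub hx _ trivial).2) hq
    have hsub := (hq.hasSum.mul_right (v 0)).sub hsx.hasSum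
    rw [hval, hmass x hx, sub_self] at hsub
    have hzero := (hasSum_zero_iff_of_nonneg fun i => by
      rw [← mul_sub]
      exact mul_nonneg (hq0 i) (sub_nonneg.2 (hle x hx i))).1 hsub
    have h0 : q 0 * v 0 - q 0 * x 0 = 0 := congrFun hzero 0
    simp only [hqdef, range_zero, sum_empty, sub_zero, one_mul] at h0
    linarith
  rw [tendsto_iff_ultrafilter]
  intro F hF
  obtain ⟨x, hx, hFx⟩ := hlim F hF
  rw [← eq_one_div_of_mul_eq_one_right hval, ← hall x hx]
  exact (tendsto_pi_nhds.1 hFx 0).congr fun n => by simp [w]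

end IsRenewal

/-- The tails of a distribution with an exponential moment are summable. -/
theorem summable_tail {f : ℕ → ℝ} (hf : ∀ i, 0 ≤ f i) (hs : HasSum f 1) {r : ℝ} (hr : 1 < r)
    (hfr : Summable fun i => f i * r ^ i) : Summable fun i => 1 - ∑ j ∈ range i, f j := by
  have hr0 : 0 < r := by linarith
  refine Summable.of_nonneg_of_le (fun i => sub_nonneg.2 (sum_le_hasSum _ (fun j _ => hf j) hs))
    (fun n => ?_) ((summable_geometric_of_lt_one (inv_nonneg.2 hr0.le)
      (inv_lt_one_of_one_lt₀ hr)).mul_left (∑' i, f i * r ^ i))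
  have htail : 1 - ∑ j ∈ range n, f j = ∑' i, f (i + n) := by
    rw [sub_eq_iff_eq_add', hs.summable.sum_add_tsum_nat_add, hs.tsum_eq]
  rw [htail, inv_pow, ← div_eq_mul_inv, le_div_iff₀ (by positivity), ← tsum_mul_right,
    ← hfr.sum_add_tsum_nat_add n]
  refine le_add_of_nonneg_of_le (sum_nonneg fun i _ => mul_nonneg (hf i) (by positivity)) ?_
  have hsn := (summable_nat_add_iff n).2 hfr
  have hle : ∀ i, f (i + n) * r ^ n ≤ f (i + n) * r ^ (i + n) := fun i =>
    mul_le_mul_of_nonneg_left (pow_le_pow_right₀ hr.le (Nat.le_add_left n i)) (hf _)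
  exact Summable.tsum_le_tsum hle
    (Summable.of_nonneg_of_le (fun i => mul_nonneg (hf _) (by positivity)) hle hsn) hsn

/-! ### Counting lists by total size -/

/-- Lists of elements of `P` of total size `n`. -/
def listsOfSize {α : Type*} (P : α → Prop) (size : α → ℕ) (n : ℕ) : Set (List α) :=
  {c | (∀ t ∈ c, P t) ∧ (c.map size).sum = n}

section listsOfSize

variable {α : Type*} {P : α → Prop} {size : α → ℕ}

theorem listsOfSize_zero (hsize : ∀ t, 0 < size t) : listsOfSize P size 0 = {[]} := by
  ext c
  cases c with
  | nil => simp [listsOfSize]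
  | cons t c => simp [listsOfSize, (hsize t).ne']

theorem listsOfSize_succ (hsize : ∀ t, 0 < size t) (n : ℕ) :
    listsOfSize P size (n + 1) = ⋃ i ∈ (range (n + 1) : Finset ℕ),
      (fun x : α × List α => x.1 :: x.2) ''
        ({t | size t = i + 1 ∧ P t} ×ˢ listsOfSize P size (n - i)) := by
  ext c
  simp only [Set.mem_iUnion, Set.mem_image, Set.mem_prod, Prod.exists, mem_range]
  constructor
  · rintro ⟨hP, hn⟩
    cases c with
    | nil => simp at hn
    | cons t c =>
      simp only [List.map_cons, List.sum_cons] at hn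
      have := hsize t
      exact ⟨size t - 1, by omega, t, c,
        ⟨⟨by omega, hP t (by simp)⟩, fun s hs => hP s (by simp [hs]), by omega⟩, rfl⟩
  · rintro ⟨i, hi, t, c, ⟨⟨ht, hPt⟩, hP, hn⟩, rfl⟩
    refine ⟨by simpa using ⟨hPt, hP⟩, ?_⟩
    simp only [List.map_cons, List.sum_cons]
    omega

theorem finite_listsOfSize (hsize : ∀ t, 0 < size t)
    (hfin : ∀ n, {t | size t = n ∧ P t}.Finite) (n : ℕ) : (listsOfSize P size n).Finite := by
  induction n using Nat.strong_induction_on with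
  | _ n ih =>
    cases n with
    | zero => simp [listsOfSize_zero hsize]
    | succ n =>
      rw [listsOfSize_succ hsize]
      exact Set.Finite.biUnion (finite_toSet _) fun i _ =>
        ((hfin _).prod (ih _ (by omega))).image _

theorem ncard_listsOfSize_succ (hsize : ∀ t, 0 < size t)
    (hfin : ∀ n, {t | size t = n ∧ P t}.Finite) (n : ℕ) :
    (listsOfSize P size (n + 1)).ncard = ∑ i ∈ range (n + 1),
      {t | size t = i + 1 ∧ P t}.ncard * (listsOfSize P size (n - i)).ncard := by
  have hinj : Function.Injective fun x : α × List α => x.1 :: x.2 := by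
    rintro ⟨a, b⟩ ⟨c, d⟩ h
    simpa using h
  rw [listsOfSize_succ hsize, ← finsum_mem_coe_finset]
  simp_rw [← mem_coe]
  rw [(finite_toSet (range (n + 1))).ncard_biUnion]
  · refine finsum_mem_congr rfl fun i _ => ?_
    rw [Set.ncard_image_of_injective _ hinj, Set.ncard_prod]
  · exact fun i _ => ((hfin _).prod (finite_listsOfSize hsize hfin _)).image _
  · intro i _ j _ hij
    refine Set.disjoint_left.2 ?_
    rintro _ ⟨⟨a, b⟩, ⟨⟨h1, -⟩, -⟩, rfl⟩ ⟨⟨c, d⟩, ⟨⟨h2, -⟩, -⟩, h⟩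
    simp only [List.cons.injEq] at h
    simp only at h1 h2
    rw [h.1, h1] at h2
    omega

end listsOfSize

/-! ### Counting decreasing trees -/

theorem LTree.size_node (l : ℕ) (c : List LTree) :
    (LTree.node l c).size = 1 + (c.map LTree.size).sum := by
  rw [LTree.size, List.attach_map_val]

theorem LTree.size_pos (t : LTree) : 0 < t.size := by
  cases t
  rw [LTree.size_node]
  omega

theorem LTree.Bounded.mono {j k : ℕ} (hjk : j ≤ k) {t : LTree} (ht : t.Bounded j) :
    t.Bounded k := by
  induction ht with
  | node l c h1 h2 _ ih => exact .node l c h1 (h2.trans hjk) ih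

theorem LTree.Bounded.label_le {k : ℕ} {t : LTree} (ht : t.Bounded k) : t.label ≤ k := by
  cases ht
  assumption

/-- In a decreasing tree the root label bounds all labels. -/
theorem LTree.Dec.bounded {t : LTree} (ht : t.Dec) {j k : ℕ} (hb : t.Bounded k)
    (hj : t.label ≤ j) : t.Bounded j := by
  induction ht with
  | node l c h1 _ ih =>
    cases hb with
    | node _ _ hl1 _ hb =>
      exact .node l c hl1 hj fun t ht => ih t ht (hb t ht) ((h1 t ht).le.trans hj)

/-- The decreasing trees with `n` nodes and labels in `{1, ..., k}`. -/
def decTrees (k n : ℕ) : Set LTree := {t | t.size = n ∧ t.Dec ∧ t.Bounded k}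

/-- The forests of decreasing trees with `n` nodes and labels in `{1, ..., k}`. -/
def decForests (k : ℕ) : ℕ → Set (List LTree) :=
  listsOfSize (fun t => t.Dec ∧ t.Bounded k) LTree.size

theorem decTrees_zero_left (n : ℕ) : decTrees 0 n = ∅ := by
  refine Set.eq_empty_of_forall_notMem ?_
  rintro _ ⟨-, -, ⟨l, c, h1, h2, -⟩⟩
  omega

theorem decTrees_zero_right (k : ℕ) : decTrees k 0 = ∅ :=
  Set.eq_empty_of_forall_notMem fun t ht => t.size_pos.ne' ht.1

theorem decTrees_succ (k n : ℕ) :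
    decTrees (k + 1) (n + 1) = decTrees k (n + 1) ∪ LTree.node (k + 1) '' decForests k n := by
  ext t
  constructor
  · rintro ⟨hn, hd, hb⟩
    rcases hb.label_le.lt_or_eq with hlt | heq
    · exact .inl ⟨hn, hd, hd.bounded hb (by omega)⟩
    · right
      cases hd with
      | node l c h1 h2 =>
        cases hb with
        | node _ _ _ _ hb =>
          obtain rfl : l = k + 1 := heq
          refine ⟨c, ⟨fun t ht => ⟨h2 t ht, (h2 t ht).bounded (hb t ht) ?_⟩, ?_⟩, rfl⟩
          · have := h1 t ht
            omega
          · rw [LTree.size_node] at hn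
            omega
  · rintro (⟨hn, hd, hb⟩ | ⟨c, ⟨hc, hn⟩, rfl⟩)
    · exact ⟨hn, hd, hb.mono k.le_succ⟩
    · refine ⟨by rw [LTree.size_node]; omega, .node _ _ (fun t ht => ?_) fun t ht => (hc t ht).1,
        .node _ _ (by omega) le_rfl fun t ht => (hc t ht).2.mono k.le_succ⟩
      have := (hc t ht).2.label_le
      omega

theorem finite_decTrees (k n : ℕ) : (decTrees k n).Finite := by
  induction k generalizing n with
  | zero => simp [decTrees_zero_left]
  | succ k ih =>
    cases n with
    | zero => simp [decTrees_zero_right]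
    | succ n =>
      rw [decTrees_succ]
      exact (ih _).union ((finite_listsOfSize LTree.size_pos ih n).image _)

theorem Gcount_zero_right (n : ℕ) : Gcount n 0 = 0 := by
  rw [Gcount, ← decTrees, decTrees_zero_left, Set.ncard_empty]

theorem Gcount_succ_succ (n k : ℕ) :
    Gcount (n + 1) (k + 1) = Gcount (n + 1) k + (decForests k n).ncard := by
  have hinj : Function.Injective (LTree.node (k + 1)) := fun a b h => by simpa using h
  have hfin : (decForests k n).Finite :=
    finite_listsOfSize LTree.size_pos (finite_decTrees k) n
  rw [Gcount, Gcount, ← decTrees, ← decTrees, decTrees_succ,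
    Set.ncard_union_eq _ (finite_decTrees _ _) (hfin.image _), Set.ncard_image_of_injective _ hinj]
  refine Set.disjoint_left.2 ?_
  rintro _ ⟨-, -, hb⟩ ⟨c, -, rfl⟩
  have := hb.label_le
  simp [LTree.label] at this

/-- Forests of decreasing trees, weighted by `z` per node, form a renewal sequence. -/
theorem isRenewal_decForests (k : ℕ) (z : ℝ) :
    IsRenewal (fun i => (Gcount (i + 1) k : ℝ) * z ^ (i + 1))
      (fun n => ((decForests k n).ncard : ℝ) * z ^ n) := by
  refine ⟨?_, fun n => ?_⟩
  · simp [decForests, listsOfSize_zero LTree.size_pos]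
  · simp only [decForests]
    rw [ncard_listsOfSize_succ LTree.size_pos (finite_decTrees k), Nat.cast_sum, sum_mul]
    refine sum_congr rfl fun i hi => ?_
    obtain ⟨j, rfl⟩ := Nat.exists_eq_add_of_le (Nat.lt_succ_iff.1 (mem_range.1 hi))
    rw [Nat.add_sub_cancel_left, Gcount]
    push_cast
    ring

/-- The generating function of `Gcount · k` within its disc of convergence. -/
theorem hasSum_Gcount {z : ℝ} (hz : 0 < z) (k : ℕ) (h : ∀ i < k, 0 < gCompl z i) :
    HasSum (fun i => (Gcount (i + 1) k : ℝ) * z ^ (i + 1)) (1 - gCompl z k) := by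
  induction k with
  | zero => simp [Gcount_zero_right, gCompl]
  | succ k ih =>
    have hpos := h k k.lt_succ_self
    have hk := ih fun i hi => h i (by omega)
    have hforest := (isRenewal_decForests k z).hasSum_of_lt_one
      (fun i => by positivity) hk (by linarith)
    have hsum := hk.add (hforest.mul_left z)
    have hval : 1 - gCompl z k + z * (1 / (1 - (1 - gCompl z k))) = 1 - gCompl z (k + 1) := by
      rw [gCompl, sub_sub_cancel]
      ring
    rw [hval] at hsum
    refine hsum.congr_fun fun i => ?_
    rw [Gcount_succ_succ]
    push_cast
    ring

theorem exists_tendsto_Gcount_mul_pow (m : ℕ) :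
    ∃ c : ℝ, 0 < c ∧ Tendsto
      (fun n => (Gcount n (m + 2) : ℝ) * (1 / invOrbit (m + 1) ^ 2) ^ n) atTop (nhds c) := by
  have hdpos := invOrbit_succ_pos m
  have hd0 := invOrbit_nonneg m
  have hdlt : invOrbit m ^ 2 < invOrbit (m + 1) ^ 2 :=
    pow_lt_pow_left₀ (invOrbit_lt_succ m) hd0 two_ne_zero
  set z : ℝ := 1 / invOrbit (m + 1) ^ 2 with hz
  have hzpos : 0 < z := by positivity
  have hsum : HasSum (fun i => (Gcount (i + 1) (m + 1) : ℝ) * z ^ (i + 1)) 1 := by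
    have := hasSum_Gcount hzpos (m + 1) fun i hi => gCompl_pos_of_mul_invOrbit_sq_lt_one hzpos
      (Nat.lt_succ_iff.1 hi) (by rwa [hz, one_div_mul_eq_div, div_lt_one (by positivity)])
    rwa [gCompl_one_div_invOrbit_sq, sub_zero] at this
  set R : ℝ := 2 / (invOrbit m ^ 2 + invOrbit (m + 1) ^ 2) with hR
  have hRpos : 0 < R := by positivity
  have hRsum := (hasSum_Gcount hRpos (m + 1) fun i hi => gCompl_pos_of_mul_invOrbit_sq_lt_one
    hRpos (Nat.lt_succ_iff.1 hi) (by
      rw [hR, div_mul_eq_mul_div, div_lt_one (by positivity)]; linarith)).summable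
  have hzR : 1 < R / z := by
    rw [one_lt_div hzpos, hz, hR, div_lt_div_iff₀ (by positivity) (by positivity)]
    linarith
  set f : ℕ → ℝ := fun i => (Gcount (i + 1) (m + 1) : ℝ) * z ^ (i + 1) with hf
  have hf0 : ∀ i, 0 ≤ f i := fun i => by positivity
  have hren := isRenewal_decForests (m + 1) z
  have hf1 : 0 < f 0 := by
    have : (decForests m 0).ncard = 1 := by simp [decForests, listsOfSize_zero LTree.size_pos]
    have hG : 0 < Gcount (0 + 1) (m + 1) := by rw [Gcount_succ_succ]; omega
    simp only [hf]
    positivity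
  have hq : Summable fun i => 1 - ∑ j ∈ range i, f j := by
    refine summable_tail hf0 hsum hzR ((hRsum.mul_left (z / R)).congr fun i => ?_)
    simp only [hf, div_pow, pow_succ]
    field_simp
  have hqpos : 0 < ∑' i, (1 - ∑ j ∈ range i, f j) :=
    hq.tsum_pos (fun i => sub_nonneg.2 (sum_le_hasSum _ (fun j _ => hf0 j) hsum)) 0 (by simp)
  have hlim := hren.tendsto hf0 hsum hf1 hq
  refine ⟨z * (1 / ∑' i, (1 - ∑ j ∈ range i, f j)), by positivity, ?_⟩
  rw [← tendsto_add_atTop_iff_nat 1]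
  have hadd := hsum.summable.tendsto_atTop_zero.add (hlim.const_mul z)
  rw [zero_add] at hadd
  refine hadd.congr fun n => ?_
  rw [Gcount_succ_succ]
  push_cast
  ring

theorem stmt9 (k : ℕ) (hk : 2 ≤ k) (zk : ℝ)
    (hzk : IsLeast {z : ℝ | 0 < z ∧ G (k - 1) z = 1} zk) :
    (∃ c : ℝ, 0 < c ∧
      Tendsto (fun n : ℕ => (Gcount n k : ℝ) / (c * (1 / zk) ^ n)) atTop (nhds 1)) ∧
    2 * ((k : ℝ) - 1) * (1 - 1 / (Real.sqrt 2 * ((k : ℝ) - 1) ^ ((1 : ℝ) / 4)))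
      ≤ 1 / zk ∧
    1 / zk ≤ 1 / (((k : ℝ) - 1) - Real.sqrt (((k : ℝ) - 1) ^ 2 - 1)) := by
  obtain ⟨m, rfl⟩ := Nat.exists_eq_add_of_le' hk
  rw [show m + 2 - 1 = m + 1 by omega] at hzk
  obtain rfl := hzk.unique (isLeast_root_G m)
  have hpos := invOrbit_succ_pos m
  have hcast : ((m + 2 : ℕ) : ℝ) - 1 = m + 1 := by push_cast; ring
  rw [hcast, one_div_one_div]
  refine ⟨?_, lower_bound_invOrbit_sq m, upper_bound_invOrbit_sq m⟩
  obtain ⟨c, hc, hlim⟩ := exists_tendsto_Gcount_mul_pow m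
  refine ⟨c, hc, ?_⟩
  have := hlim.div_const c
  rw [div_self hc.ne'] at this
  refine this.congr fun n => ?_
  rw [div_pow, one_pow]
  field_simp
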